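/- Let ν be a probability measure on ℝ with continuous positive density f with respect to the standard Gaussian measure γ, and let T = F_ν^{-1} ∘ F_γ be the increasing transport map pushing γ forward onto ν. Then 2 H(ν|γ) − W₂²(ν, γ) ≥ ∫_ℝ ( T′(x) − 1 − log T′(x) ) dγ(x). -/

import Mathlib

open MeasureTheory Real Filter Asymptotics
open scoped ENNReal Topology

noncomputable section

/-- `ℝⁿ` with the Euclidean structure. -/
abbrev En (n : ℕ) := EuclideanSpace ℝ (Fin n)

/-- Density `φₙ` of the standard Gaussian measure on `ℝⁿ`. -/
def phiN (n : ℕ) (x : En n) : ℝ := (2 * π) ^ (-(n : ℝ) / 2) * Real.exp (-‖x‖ ^ 2 / 2)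

/-- The standard Gaussian measure `γₙ` on `ℝⁿ`. -/
def gaussianN (n : ℕ) : Measure (En n) :=
  volume.withDensity fun x => ENNReal.ofReal (phiN n x)

/-- Density `φ` of the standard Gaussian measure on `ℝ`. -/
def phi1 (x : ℝ) : ℝ := (2 * π) ^ (-(1 : ℝ) / 2) * Real.exp (-x ^ 2 / 2)

/-- The standard Gaussian measure `γ` on `ℝ`. -/
def gaussian1 : Measure ℝ := volume.withDensity fun x => ENNReal.ofReal (phi1 x)

/-- Entropy `Ent_μ(f) = ∫ f log f dμ - (∫ f dμ) log (∫ f dμ)`. -/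
def gEnt {α : Type*} [MeasurableSpace α] (μ : Measure α) (f : α → ℝ) : ℝ :=
  (∫ x, f x * Real.log (f x) ∂μ) - (∫ x, f x ∂μ) * Real.log (∫ x, f x ∂μ)

/-- Cumulative distribution function of the measure with density `u` on `ℝ`. -/
def cdfD (u : ℝ → ℝ) (x : ℝ) : ℝ := ∫ y in Set.Iic x, u y

/-- (Generalized) inverse of the cumulative distribution function of the density `v`. -/
def invCdfD (v : ℝ → ℝ) (t : ℝ) : ℝ := sInf {y : ℝ | t ≤ cdfD v y}

/-- The increasing map `T = F_ν⁻¹ ∘ F_μ` transporting `μ(dx) = u(x)dx` onto `ν(dx) = v(x)dx`. -/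
def transportD (u v : ℝ → ℝ) (x : ℝ) : ℝ := invCdfD v (cdfD u x)

/-- The Bucur–Fragalà distance (modulo translation)
`d(u,v) = ∫ |1 - T'| / max 1 T' dμ` between one-dimensional densities. -/
def dBF (u v : ℝ → ℝ) : ℝ :=
  ∫ x, |1 - deriv (transportD u v) x| / max 1 (deriv (transportD u v) x) * u x

/-- The squared Kantorovich–Wasserstein distance `W₂²(μ,ν)` between measures on `ℝ`:
the infimum of `∬ |x-y|² dπ` over all couplings `π` of `μ` and `ν`. -/
def W2sqR (μ ν : Measure ℝ) : ℝ≥0∞ :=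
  ⨅ (cpl : Measure (ℝ × ℝ)) (_ : cpl.map Prod.fst = μ) (_ : cpl.map Prod.snd = ν),
    ∫⁻ p, ENNReal.ofReal ((p.1 - p.2) ^ 2) ∂cpl

section helpers

/-- Measure with density `u`. -/
def mD (u : ℝ → ℝ) : Measure ℝ := volume.withDensity fun x => ENNReal.ofReal (u x)

lemma mD_real_Iic (u : ℝ → ℝ) (hc : Continuous u) (hp : ∀ x, 0 < u x) (x : ℝ) :
    (mD u).real (Set.Iic x) = cdfD u x := by
  unfold mD cdfD
  rw [measureReal_def, withDensity_apply _ measurableSet_Iic,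
    integral_eq_lintegral_of_nonneg_ae (Eventually.of_forall fun x => (hp x).le)
      hc.aestronglyMeasurable]

lemma mD_integrable (u : ℝ → ℝ) (hc : Continuous u) (hp : ∀ x, 0 < u x) {g : ℝ → ℝ} :
    Integrable g (mD u) ↔ Integrable (fun x => u x * g x) := by
  unfold mD
  rw [integrable_withDensity_iff_integrable_smul' hc.measurable.ennreal_ofReal
    (Eventually.of_forall fun x => ENNReal.ofReal_lt_top)]
  simp only [ENNReal.toReal_ofReal (hp _).le, smul_eq_mul]

lemma mD_integral (u : ℝ → ℝ) (hc : Continuous u) (hp : ∀ x, 0 < u x) (g : ℝ → ℝ) :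
    ∫ x, g x ∂(mD u) = ∫ x, u x * g x := by
  unfold mD
  rw [integral_withDensity_eq_integral_toReal_smul hc.measurable.ennreal_ofReal
    (Eventually.of_forall fun x => ENNReal.ofReal_lt_top)]
  simp only [ENNReal.toReal_ofReal (hp _).le, smul_eq_mul]

lemma mD_int_self (u : ℝ → ℝ) (hc : Continuous u) (hp : ∀ x, 0 < u x)
    [IsProbabilityMeasure (mD u)] : Integrable u := by
  simpa using (mD_integrable u hc hp).1 (integrable_const (1 : ℝ))

lemma cdfD_hasDerivAt (u : ℝ → ℝ) (hc : Continuous u) (hp : ∀ x, 0 < u x)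
    [IsProbabilityMeasure (mD u)] (x : ℝ) : HasDerivAt (cdfD u) (u x) x := by
  have hi := mD_int_self u hc hp
  have h : cdfD u = fun y => cdfD u 0 + ∫ t in (0 : ℝ)..y, u t := by
    funext y
    rw [← intervalIntegral.integral_Iic_sub_Iic hi.integrableOn hi.integrableOn]
    simp [cdfD]
  rw [h]
  exact (hc.integral_hasStrictDerivAt 0 x).hasDerivAt.const_add _

lemma cdfD_strictMono (u : ℝ → ℝ) (hc : Continuous u) (hp : ∀ x, 0 < u x)
    [IsProbabilityMeasure (mD u)] : StrictMono (cdfD u) :=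
  strictMono_of_hasDerivAt_pos (cdfD_hasDerivAt u hc hp) hp

lemma cdfD_eq_cdf (u : ℝ → ℝ) (hc : Continuous u) (hp : ∀ x, 0 < u x)
    [IsProbabilityMeasure (mD u)] : cdfD u = ProbabilityTheory.cdf (mD u) := by
  funext x
  rw [ProbabilityTheory.cdf_eq_real, mD_real_Iic u hc hp]

lemma cdfD_mem (u : ℝ → ℝ) (hc : Continuous u) (hp : ∀ x, 0 < u x)
    [IsProbabilityMeasure (mD u)] (x : ℝ) : cdfD u x ∈ Set.Ioo (0 : ℝ) 1 := by
  have hm := cdfD_strictMono u hc hp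
  have h1 := hm (sub_one_lt x)
  have h2 := hm (lt_add_one x)
  have h3 := ProbabilityTheory.cdf_nonneg (mD u) (x - 1)
  have h4 := ProbabilityTheory.cdf_le_one (mD u) (x + 1)
  rw [← cdfD_eq_cdf u hc hp] at h3 h4
  exact ⟨by linarith, by linarith⟩

lemma cdfD_surj (u : ℝ → ℝ) (hc : Continuous u) (hp : ∀ x, 0 < u x)
    [IsProbabilityMeasure (mD u)] {t : ℝ} (ht : t ∈ Set.Ioo (0 : ℝ) 1) :
    ∃ x, cdfD u x = t := by
  have hcont : Continuous (cdfD u) :=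
    continuous_iff_continuousAt.2 fun x => (cdfD_hasDerivAt u hc hp x).continuousAt
  refine mem_range_of_exists_le_of_exists_ge hcont ?_ ?_
  · have := ProbabilityTheory.tendsto_cdf_atBot (mD u)
    rw [← cdfD_eq_cdf u hc hp] at this
    exact (this.eventually (gt_mem_nhds ht.1)).exists.imp fun _ h => h.le
  · have := ProbabilityTheory.tendsto_cdf_atTop (mD u)
    rw [← cdfD_eq_cdf u hc hp] at this
    exact (this.eventually (lt_mem_nhds ht.2)).exists.imp fun _ h => h.le

lemma invCdfD_cdfD (u : ℝ → ℝ) (hc : Continuous u) (hp : ∀ x, 0 < u x)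
    [IsProbabilityMeasure (mD u)] (y : ℝ) : invCdfD u (cdfD u y) = y := by
  unfold invCdfD
  have : {z : ℝ | cdfD u y ≤ cdfD u z} = Set.Ici y := by
    ext z
    simp [(cdfD_strictMono u hc hp).le_iff_le]
  rw [this, csInf_Ici]

lemma cdfD_invCdfD (u : ℝ → ℝ) (hc : Continuous u) (hp : ∀ x, 0 < u x)
    [IsProbabilityMeasure (mD u)] {t : ℝ} (ht : t ∈ Set.Ioo (0 : ℝ) 1) :
    cdfD u (invCdfD u t) = t := by
  obtain ⟨y, rfl⟩ := cdfD_surj u hc hp ht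
  rw [invCdfD_cdfD u hc hp]

lemma invCdfD_hasDerivAt (u : ℝ → ℝ) (hc : Continuous u) (hp : ∀ x, 0 < u x)
    [IsProbabilityMeasure (mD u)] {t : ℝ} (ht : t ∈ Set.Ioo (0 : ℝ) 1) :
    HasDerivAt (invCdfD u) (u (invCdfD u t))⁻¹ t := by
  have hn : Set.Ioo (0 : ℝ) 1 ∈ 𝓝 t := isOpen_Ioo.mem_nhds ht
  refine HasDerivAt.of_local_left_inverse ?_ (cdfD_hasDerivAt u hc hp _) (hp _).ne' ?_
  · refine continuousAt_of_monotoneOn_of_image_mem_nhds (s := Set.Ioo (0 : ℝ) 1) ?_ hn ?_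
    · intro a ha b hb hab
      rw [← (cdfD_strictMono u hc hp).le_iff_le, cdfD_invCdfD u hc hp ha,
        cdfD_invCdfD u hc hp hb]
      exact hab
    · have : invCdfD u '' Set.Ioo (0 : ℝ) 1 = Set.univ := by
        refine Set.eq_univ_of_forall fun y => ⟨cdfD u y, cdfD_mem u hc hp y, ?_⟩
        exact invCdfD_cdfD u hc hp y
      rw [this]
      exact univ_mem
  · filter_upwards [hn] with s hs using cdfD_invCdfD u hc hp hs

lemma transportD_hasDerivAt (u v : ℝ → ℝ) (hc : Continuous u) (hp : ∀ x, 0 < u x)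
    (hc' : Continuous v) (hp' : ∀ x, 0 < v x)
    [IsProbabilityMeasure (mD u)] [IsProbabilityMeasure (mD v)] (x : ℝ) :
    HasDerivAt (transportD u v) ((v (transportD u v x))⁻¹ * u x) x :=
  HasDerivAt.comp x (invCdfD_hasDerivAt v hc' hp' (cdfD_mem u hc hp x)) (cdfD_hasDerivAt u hc hp x)

lemma transportD_map (u v : ℝ → ℝ) (hc : Continuous u) (hp : ∀ x, 0 < u x)
    (hc' : Continuous v) (hp' : ∀ x, 0 < v x)
    [IsProbabilityMeasure (mD u)] [IsProbabilityMeasure (mD v)]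
    (hm : Measurable (transportD u v)) :
    (mD u).map (transportD u v) = mD v := by
  have : IsProbabilityMeasure ((mD u).map (transportD u v)) :=
    Measure.isProbabilityMeasure_map hm.aemeasurable
  refine Measure.ext_of_Iic _ _ fun y => ?_
  rw [Measure.map_apply hm measurableSet_Iic]
  obtain ⟨x0, hx0⟩ := cdfD_surj u hc hp (cdfD_mem v hc' hp' y)
  have : transportD u v ⁻¹' Set.Iic y = Set.Iic x0 := by
    ext x
    simp only [Set.mem_preimage, Set.mem_Iic, transportD]
    rw [← (cdfD_strictMono v hc' hp').le_iff_le, cdfD_invCdfD v hc' hp' (cdfD_mem u hc hp x),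
      ← hx0, (cdfD_strictMono u hc hp).le_iff_le]
  rw [this, ← measureReal_eq_measureReal_iff, mD_real_Iic u hc hp, mD_real_Iic v hc' hp', hx0]

/-- An integrable function is bounded by one arbitrarily far to the right. -/
lemma exists_small (w : ℝ → ℝ) (hw : Integrable w) (n : ℝ) : ∃ b ≥ n, |w b| ≤ 1 := by
  by_contra! h
  have h1 : IntegrableOn (fun _ : ℝ => (1 : ℝ)) (Set.Ici n) := by
    refine Integrable.mono' (hw.norm.integrableOn (s := Set.Ici n)) (by fun_prop) ?_
    filter_upwards [ae_restrict_mem measurableSet_Ici] with x hx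
    simpa using (h x hx).le
  rw [integrableOn_const_iff] at h1
  simp at h1

/-- If `w' = p - q` with `p ≥ 0` and `w, q` integrable, then `p` is integrable. -/
lemma integrable_of_deriv (w p q : ℝ → ℝ) (hd : ∀ x, HasDerivAt w (p x - q x) x)
    (hp : ∀ x, 0 ≤ p x) (hpc : Continuous p) (hw : Integrable w) (hq : Integrable q) :
    Integrable p := by
  choose b hb hb1 using fun n : ℕ => exists_small w hw n
  choose a ha ha1 using fun n : ℕ => exists_small (fun x => w (-x)) hw.comp_neg n
  have hbt : Tendsto b atTop atTop := tendsto_atTop_mono hb tendsto_natCast_atTop_atTop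
  have hat : Tendsto (fun n => -a n) atTop atBot :=
    tendsto_neg_atTop_atBot.comp (tendsto_atTop_mono ha tendsto_natCast_atTop_atTop)
  refine integrable_of_intervalIntegral_norm_bounded (1 + 1 + ∫ x, ‖q x‖)
    (fun i => hpc.integrableOn_Ioc) hat hbt (Eventually.of_forall fun i => ?_)
  have hab : -a i ≤ b i := by
    have := hb i; have := ha i; have : (0 : ℝ) ≤ i := by positivity
    linarith
  have h1 := intervalIntegral.integral_eq_sub_of_hasDerivAt (a := -a i) (b := b i)
    (fun x _ => hd x) ((hpc.intervalIntegrable _ _).sub hq.intervalIntegrable)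
  rw [intervalIntegral.integral_sub (hpc.intervalIntegrable _ _) hq.intervalIntegrable] at h1
  have h2 : ∫ x in (-a i)..(b i), q x ≤ ∫ x, ‖q x‖ := by
    rw [intervalIntegral.integral_of_le hab]
    calc _ ≤ ∫ x in Set.Ioc (-a i) (b i), ‖q x‖ :=
          integral_mono hq.integrableOn hq.norm.integrableOn fun x => le_abs_self _
      _ ≤ _ := setIntegral_le_integral hq.norm (Eventually.of_forall fun x => norm_nonneg _)
  have h3 : ∫ x in (-a i)..(b i), ‖p x‖ = ∫ x in (-a i)..(b i), p x := by
    congr 1; funext x; exact Real.norm_of_nonneg (hp x)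
  have h4 := abs_le.1 (hb1 i)
  have h5 := abs_le.1 (ha1 i)
  linarith

lemma phi1_eq : phi1 = ProbabilityTheory.gaussianPDFReal 0 1 := by
  funext x
  simp only [phi1, ProbabilityTheory.gaussianPDFReal, NNReal.coe_one, mul_one, sub_zero]
  congr 1
  rw [Real.sqrt_eq_rpow, ← Real.rpow_neg (by positivity)]
  norm_num

lemma phi1_pos (x : ℝ) : 0 < phi1 x := by unfold phi1; positivity

lemma phi1_cont : Continuous phi1 := by unfold phi1; fun_prop

lemma phi1_deriv (x : ℝ) : HasDerivAt phi1 (-x * phi1 x) x := by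
  unfold phi1
  have : HasDerivAt (fun x : ℝ => -x ^ 2 / 2) (-x) x := by
    exact (((hasDerivAt_pow 2 x).neg).div_const 2).congr_deriv (by simp; ring)
  exact ((this.exp).const_mul ((2 * π) ^ (-(1 : ℝ) / 2))).congr_deriv (by ring)

lemma gaussian1_eq : gaussian1 = ProbabilityTheory.gaussianReal 0 1 := by
  rw [ProbabilityTheory.gaussianReal_of_var_ne_zero _ one_ne_zero]
  unfold gaussian1
  rw [phi1_eq]
  rfl

lemma phi1_exp_int : Integrable (fun x : ℝ => phi1 x * Real.exp (x ^ 2 / 4)) := by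
  have := (integrable_exp_neg_mul_sq (b := 1 / 4) (by norm_num)).const_mul
    ((2 * π) ^ (-(1 : ℝ) / 2))
  refine this.congr (Eventually.of_forall fun x => ?_)
  simp only [phi1, mul_assoc]
  rw [← Real.exp_add]
  congr 2
  ring

lemma young (s t : ℝ) (hs : 0 < s) : s * t ≤ s * Real.log s - s + Real.exp t := by
  have h := Real.add_one_le_exp (t - Real.log s)
  rw [Real.exp_sub, Real.exp_log hs] at h
  have := mul_le_mul_of_nonneg_left h hs.le
  rw [mul_div_cancel₀ _ hs.ne'] at this
  linarith

end helpers

/-- Cordero-Erausquin's one-dimensional bound on the Talagrand deficit: for a probability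
measure `ν` on `ℝ` with continuous positive density `f` w.r.t. `γ` and `T = F_ν⁻¹ ∘ F_γ`
the increasing transport map pushing `γ` onto `ν`,
`2H(ν|γ) - W₂²(ν,γ) ≥ ∫ (T' - 1 - log T') dγ`. -/
theorem talagrand_deficit_ge_integral (f : ℝ → ℝ) (hcont : Continuous f)
    (hpos : ∀ x, 0 < f x) (ν : Measure ℝ)
    (hν : ν = gaussian1.withDensity fun x => ENNReal.ofReal (f x))
    (hprob : IsProbabilityMeasure ν)
    (hH : Integrable (fun x => Real.log (f x)) ν)
    (T : ℝ → ℝ) (hT : T = transportD phi1 fun x => f x * phi1 x) :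
    2 * (∫ x, Real.log (f x) ∂ν) - (W2sqR ν gaussian1).toReal ≥
      ∫ x, (deriv T x - 1 - Real.log (deriv T x)) ∂gaussian1 := by
  have hφc := phi1_cont
  have hφp := phi1_pos
  have hγ : gaussian1 = mD phi1 := rfl
  set v : ℝ → ℝ := fun x => f x * phi1 x with hv
  have hvc : Continuous v := hcont.mul hφc
  have hvp : ∀ x, 0 < v x := fun x => mul_pos (hpos x) (hφp x)
  have hνv : ν = mD v := by
    rw [hν, gaussian1, mD, ← withDensity_mul _ hφc.measurable.ennreal_ofReal
      hcont.measurable.ennreal_ofReal]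
    congr 1
    funext x
    simp only [Pi.mul_apply, hv]
    rw [mul_comm, ENNReal.ofReal_mul (hpos x).le]
  have i1 : IsProbabilityMeasure (mD phi1) := by
    rw [← hγ, gaussian1_eq]; infer_instance
  have i2 : IsProbabilityMeasure (mD v) := hνv ▸ hprob
  have hTd : ∀ x, HasDerivAt T ((v (T x))⁻¹ * phi1 x) x := by
    intro x; rw [hT]; exact transportD_hasDerivAt phi1 v hφc hφp hvc hvp x
  have hTc : Continuous T := continuous_iff_continuousAt.2 fun x => (hTd x).continuousAt
  have hTm : Measurable T := hTc.measurable
  have hmap : (mD phi1).map T = mD v := by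
    subst hT; exact transportD_map phi1 v hφc hφp hvc hvp hTm
  set D : ℝ → ℝ := fun x => (v (T x))⁻¹ * phi1 x with hD
  have hDc : Continuous D := ((hvc.comp hTc).inv₀ fun x => (hvp _).ne').mul hφc
  have hDp : ∀ x, 0 < D x := fun x => mul_pos (inv_pos.2 (hvp _)) (hφp x)
  have hder : deriv T = D := funext fun x => (hTd x).deriv
  rw [hνv] at hH
  rw [hder, hνv, hγ]
  have hlogc : Continuous fun x => Real.log (f x) := hcont.log fun x => (hpos x).ne'
  have hx2 : Integrable (fun x : ℝ => x ^ 2) (mD phi1) := by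
    rw [mD_integrable phi1 hφc hφp]
    refine (phi1_exp_int.const_mul 4).mono' (by fun_prop) (Eventually.of_forall fun x => ?_)
    have h1 := Real.add_one_le_exp (x ^ 2 / 4)
    have h2 : x ^ 2 ≤ 4 * Real.exp (x ^ 2 / 4) := by linarith
    rw [Real.norm_of_nonneg (mul_nonneg (hφp x).le (sq_nonneg x))]
    calc _ ≤ phi1 x * (4 * Real.exp (x ^ 2 / 4)) := mul_le_mul_of_nonneg_left h2 (hφp x).le
      _ = _ := by ring
  have hν2 : Integrable (fun x : ℝ => x ^ 2) (mD v) := by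
    rw [mD_integrable v hvc hvp]
    have h3 := (mD_integrable v hvc hvp).1 hH
    refine (((h3.sub (mD_int_self v hvc hvp)).add phi1_exp_int).const_mul 4).mono'
      (by fun_prop) (Eventually.of_forall fun x => ?_)
    rw [Real.norm_of_nonneg (mul_nonneg (hvp x).le (sq_nonneg x))]
    have h1 := young (f x) (x ^ 2 / 4) (hpos x)
    have h2 := mul_le_mul_of_nonneg_left h1 (hφp x).le
    simp only [Pi.add_apply, Pi.sub_apply, hv]
    linarith
  have hT2 : Integrable (fun x : ℝ => T x ^ 2) (mD phi1) := by
    rw [← hmap] at hν2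
    exact (integrable_map_measure (by fun_prop) hTm.aemeasurable).1 hν2
  have hL : Integrable (fun x : ℝ => Real.log (f (T x))) (mD phi1) := by
    rw [← hmap] at hH
    exact (integrable_map_measure hlogc.aestronglyMeasurable hTm.aemeasurable).1 hH
  have hLeq : ∫ x, Real.log (f x) ∂(mD v) = ∫ x, Real.log (f (T x)) ∂(mD phi1) := by
    rw [← hmap, integral_map hTm.aemeasurable hlogc.aestronglyMeasurable]
  have hmT : MemLp T 2 (mD phi1) := (memLp_two_iff_integrable_sq hTc.aestronglyMeasurable).2 hT2
  have hmx : MemLp (fun x : ℝ => x) 2 (mD phi1) :=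
    (memLp_two_iff_integrable_sq (by fun_prop)).2 hx2
  have hmS : MemLp (fun x : ℝ => T x - x) 2 (mD phi1) := hmT.sub hmx
  have hxT : Integrable (fun x => x * T x) (mD phi1) := hmx.integrable_mul hmT
  have hxS : Integrable (fun x => x * (T x - x)) (mD phi1) := hmx.integrable_mul hmS
  have hS2 : Integrable (fun x => (T x - x) ^ 2) (mD phi1) := hmS.integrable_sq
  have hTi : Integrable T (mD phi1) := hmT.integrable (by norm_num)
  have hSi : Integrable (fun x => T x - x) (mD phi1) := hmS.integrable (by norm_num)
  have hDi : Integrable D (mD phi1) := by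
    rw [mD_integrable phi1 hφc hφp] at hTi hxT ⊢
    refine integrable_of_deriv (fun x => phi1 x * T x) _ (fun x => phi1 x * (x * T x)) ?_
      (fun x => mul_nonneg (hφp x).le (hDp x).le) (hφc.mul hDc) hTi hxT
    intro x
    exact ((phi1_deriv x).mul (hTd x)).congr_deriv (by simp only [hD]; ring)
  have hD1 : Integrable (fun x => D x - 1) (mD phi1) := hDi.sub (integrable_const 1)
  have hIBP : ∫ x, ((D x - 1) - x * (T x - x)) ∂(mD phi1) = 0 := by
    have hI := hD1.sub hxS
    rw [mD_integral phi1 hφc hφp]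
    refine integral_eq_zero_of_hasDerivAt_of_integrable (f := fun x => phi1 x * (T x - x)) ?_
      ((mD_integrable phi1 hφc hφp).1 hI) ((mD_integrable phi1 hφc hφp).1 hSi)
    intro x
    exact ((phi1_deriv x).mul ((hTd x).sub (hasDerivAt_id x))).congr_deriv
      (by simp only [hD, Pi.sub_apply, id]; ring)
  have hMA : ∀ x, D x - 1 - Real.log (D x) =
      Real.log (f (T x)) - (T x - x) ^ 2 / 2 + ((D x - 1) - x * (T x - x)) := by
    intro x
    have hlp : ∀ y, Real.log (phi1 y) = Real.log ((2 * π) ^ (-(1 : ℝ) / 2)) + -y ^ 2 / 2 := by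
      intro y
      rw [phi1, Real.log_mul (by positivity) (Real.exp_pos _).ne', Real.log_exp]
    have : Real.log (D x) = -(Real.log (f (T x)) + Real.log (phi1 (T x))) + Real.log (phi1 x) := by
      simp only [hD, hv]
      rw [Real.log_mul (inv_pos.2 (hvp _)).ne' (hφp x).ne', Real.log_inv,
        Real.log_mul (hpos _).ne' (hφp _).ne']
    rw [this, hlp, hlp]
    ring
  have hg : ∫ x, (D x - 1 - Real.log (D x)) ∂(mD phi1) =
      ∫ x, Real.log (f (T x)) ∂(mD phi1) - (∫ x, (T x - x) ^ 2 ∂(mD phi1)) / 2 := by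
    simp only [hMA]
    have e1 : Integrable (fun x => Real.log (f (T x)) - (T x - x) ^ 2 / 2) (mD phi1) :=
      hL.sub (hS2.div_const 2)
    have e2 : Integrable (fun x => (D x - 1) - x * (T x - x)) (mD phi1) := hD1.sub hxS
    rw [integral_add e1 e2, hIBP, add_zero,
      integral_sub hL (hS2.div_const 2), integral_div]
  have hg0 : 0 ≤ ∫ x, (D x - 1 - Real.log (D x)) ∂(mD phi1) :=
    integral_nonneg fun x => by
      have := Real.log_le_sub_one_of_pos (hDp x)
      simp only [Pi.zero_apply]; linarith
  have hW : (W2sqR (mD v) (mD phi1)).toReal ≤ ∫ x, (T x - x) ^ 2 ∂(mD phi1) := by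
    refine ENNReal.toReal_le_of_le_ofReal (integral_nonneg fun x => sq_nonneg _) ?_
    have hpm : Measurable fun x => (T x, x) := hTm.prodMk measurable_id
    refine iInf_le_of_le ((mD phi1).map fun x => (T x, x)) ?_
    refine iInf_le_of_le ?_ ?_
    · rw [Measure.map_map measurable_fst hpm, ← hmap]; rfl
    refine iInf_le_of_le ?_ ?_
    · rw [Measure.map_map measurable_snd hpm]
      exact Measure.map_id
    · rw [lintegral_map (by fun_prop) hpm,
        ofReal_integral_eq_lintegral_ofReal hS2 (Eventually.of_forall fun x => sq_nonneg _)]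
  rw [hLeq]
  linarith

end
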